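/- Fix integers N ≥ 1, m ≥ 1, a constant k > 0 and two distinct points x, y ∈ ℝ^N_+. Then for all R ≤ R' such that x, y ∈ B_R^+ one has ψ_R^+(x,y) ≤ ψ_{R'}^+(x,y) and hence G_R^+(x,y) ≤ G_{R'}^+(x,y); moreover ψ_R^+(x,y) → ψ_∞(x,y) and G_R^+(x,y) → G_∞^+(x,y) as R → ∞. In other words, the Green kernels G_R^+ of the balls B_R^+ converge pointwise and monotonically increasingly to the half-space kernel G_∞^+. -/

import Mathlib

/-- The point `P_R = (R,0,…,0)` in `ℝ^N`. -/
noncomputable def PP (N : ℕ) [NeZero N] (R : ℝ) : EuclideanSpace ℝ (Fin N) :=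
  EuclideanSpace.single 0 R

/-- `ψ_R^+(x,y) = (R²-|x-P_R|²)(R²-|y-P_R|²)/(R²|x-y|²)`. -/
noncomputable def psiR (N : ℕ) [NeZero N] (R : ℝ) (x y : EuclideanSpace ℝ (Fin N)) : ℝ :=
  (R ^ 2 - ‖x - PP N R‖ ^ 2) * (R ^ 2 - ‖y - PP N R‖ ^ 2) / (R ^ 2 * ‖x - y‖ ^ 2)

/-- The Green kernel `G_R^+` of `(-Δ)^m` on the ball `B_R^+ = B_R(P_R)` with constant `k`. -/
noncomputable def GreenBall (N m : ℕ) [NeZero N] (k R : ℝ)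
    (x y : EuclideanSpace ℝ (Fin N)) : ℝ :=
  k / 2 * ‖x - y‖ ^ (2 * (m : ℝ) - N) *
    ∫ z in (0 : ℝ)..(psiR N R x y), z ^ (m - 1) * (z + 1) ^ (-(N : ℝ) / 2)

/-- `ψ_∞(x,y) = 4x₁y₁/|x-y|²`. -/
noncomputable def psiInf {N : ℕ} [NeZero N] (x y : EuclideanSpace ℝ (Fin N)) : ℝ :=
  4 * x 0 * y 0 / ‖x - y‖ ^ 2

/-- The half-space Green kernel `G_∞^+` of `(-Δ)^m` on `ℝ^N_+` with constant `k`. -/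
noncomputable def GreenHalf (N m : ℕ) [NeZero N] (k : ℝ)
    (x y : EuclideanSpace ℝ (Fin N)) : ℝ :=
  k / 2 * ‖x - y‖ ^ (2 * (m : ℝ) - N) *
    ∫ z in (0 : ℝ)..(psiInf x y), z ^ (m - 1) * (z + 1) ^ (-(N : ℝ) / 2)

theorem sq_sub_norm_sub_PP_sq {N : ℕ} [NeZero N] (R : ℝ) (x : EuclideanSpace ℝ (Fin N)) :
    R ^ 2 - ‖x - PP N R‖ ^ 2 = 2 * R * x 0 - ‖x‖ ^ 2 := by
  have hinner : inner ℝ x (PP N R) = R * x 0 := by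
    simp [PP, EuclideanSpace.inner_single_right]
  have hnorm : ‖PP N R‖ ^ 2 = R ^ 2 := by simp [PP]
  rw [norm_sub_sq_real, hinner, hnorm]
  ring

theorem psiR_eq {N : ℕ} [NeZero N] {R : ℝ} (hR : R ≠ 0) (x y : EuclideanSpace ℝ (Fin N)) :
    psiR N R x y = (2 * x 0 - ‖x‖ ^ 2 / R) * (2 * y 0 - ‖y‖ ^ 2 / R) / ‖x - y‖ ^ 2 := by
  have hfactor : ∀ z : EuclideanSpace ℝ (Fin N),
      2 * R * z 0 - ‖z‖ ^ 2 = R * (2 * z 0 - ‖z‖ ^ 2 / R) := fun z => by field_simp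
  rw [psiR, sq_sub_norm_sub_PP_sq, sq_sub_norm_sub_PP_sq, hfactor x, hfactor y,
    show ∀ a b : ℝ, R * a * (R * b) = R ^ 2 * (a * b) from fun a b => by ring,
    mul_div_mul_left _ _ (pow_ne_zero 2 hR)]

theorem two_mul_sub_norm_sq_div_pos {N : ℕ} [NeZero N] {R : ℝ}
    {x : EuclideanSpace ℝ (Fin N)} (hx : ‖x - PP N R‖ < R) :
    0 < 2 * x 0 - ‖x‖ ^ 2 / R := by
  have hR : 0 < R := (norm_nonneg _).trans_lt hx
  have hpos : 0 < 2 * R * x 0 - ‖x‖ ^ 2 := by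
    rw [← sq_sub_norm_sub_PP_sq]
    exact sub_pos.2 (pow_lt_pow_left₀ hx (norm_nonneg _) two_ne_zero)
  rw [sub_pos, div_lt_iff₀ hR]
  linarith

theorem psiR_nonneg {N : ℕ} [NeZero N] {R : ℝ} {x y : EuclideanSpace ℝ (Fin N)}
    (hx : ‖x - PP N R‖ < R) (hy : ‖y - PP N R‖ < R) : 0 ≤ psiR N R x y := by
  rw [psiR_eq ((norm_nonneg _).trans_lt hx).ne']
  have := two_mul_sub_norm_sq_div_pos hx
  have := two_mul_sub_norm_sq_div_pos hy
  positivity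

theorem psiR_mono {N : ℕ} [NeZero N] {R R' : ℝ} {x y : EuclideanSpace ℝ (Fin N)}
    (h : R ≤ R') (hx : ‖x - PP N R‖ < R) (hy : ‖y - PP N R‖ < R) :
    psiR N R x y ≤ psiR N R' x y := by
  have hR : 0 < R := (norm_nonneg _).trans_lt hx
  rw [psiR_eq hR.ne', psiR_eq (hR.trans_le h).ne']
  have hfactor : ∀ z : EuclideanSpace ℝ (Fin N),
      2 * z 0 - ‖z‖ ^ 2 / R ≤ 2 * z 0 - ‖z‖ ^ 2 / R' := fun z => by gcongr
  exact div_le_div_of_nonneg_right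
    (mul_le_mul (hfactor x) (hfactor y) (two_mul_sub_norm_sq_div_pos hy).le
      ((two_mul_sub_norm_sq_div_pos hx).le.trans (hfactor x))) (by positivity)

theorem tendsto_psiR {N : ℕ} [NeZero N] (x y : EuclideanSpace ℝ (Fin N)) :
    Filter.Tendsto (fun R => psiR N R x y) Filter.atTop (nhds (psiInf x y)) := by
  have hfactor : ∀ z : EuclideanSpace ℝ (Fin N),
      Filter.Tendsto (fun R : ℝ => 2 * z 0 - ‖z‖ ^ 2 / R) Filter.atTop (nhds (2 * z 0)) :=
    fun z => by simpa using tendsto_const_nhds.sub (Filter.Tendsto.const_div_atTop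
      (Filter.tendsto_id (α := ℝ)) (‖z‖ ^ 2))
  have hlim := ((hfactor x).mul (hfactor y)).div_const (‖x - y‖ ^ 2)
  rw [show 2 * x 0 * (2 * y 0) / ‖x - y‖ ^ 2 = psiInf x y by rw [psiInf]; ring] at hlim
  refine hlim.congr' ?_
  filter_upwards [Filter.eventually_ne_atTop 0] with R hR
  exact (psiR_eq hR x y).symm

theorem continuousAt_greenIntegrand (n : ℕ) (s : ℝ) {z : ℝ} (hz : 0 ≤ z) :
    ContinuousAt (fun z : ℝ => z ^ n * (z + 1) ^ s) z :=
  (continuousAt_id.pow n).mul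
    ((continuousAt_id.add continuousAt_const).rpow_const (Or.inl (by simp; positivity)))

theorem intervalIntegrable_greenIntegrand (n : ℕ) (s : ℝ) {a b : ℝ} (ha : 0 ≤ a) (hb : 0 ≤ b) :
    IntervalIntegrable (fun z : ℝ => z ^ n * (z + 1) ^ s) MeasureTheory.volume a b :=
  ContinuousOn.intervalIntegrable fun _ hz =>
    (continuousAt_greenIntegrand n s ((le_min ha hb).trans hz.1)).continuousWithinAt

theorem integral_greenIntegrand_mono (n : ℕ) (s : ℝ) {a b : ℝ} (ha : 0 ≤ a) (hab : a ≤ b) :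
    ∫ z in (0 : ℝ)..a, z ^ n * (z + 1) ^ s ≤ ∫ z in (0 : ℝ)..b, z ^ n * (z + 1) ^ s := by
  have hb := ha.trans hab
  rw [← intervalIntegral.integral_add_adjacent_intervals
    (intervalIntegrable_greenIntegrand n s le_rfl ha)
    (intervalIntegrable_greenIntegrand n s ha hb), le_add_iff_nonneg_right]
  refine intervalIntegral.integral_nonneg hab fun z hz => ?_
  have : 0 ≤ z := ha.trans hz.1
  positivity

theorem continuousAt_integral_greenIntegrand (n : ℕ) (s : ℝ) {b : ℝ} (hb : 0 ≤ b) :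
    ContinuousAt (fun b => ∫ z in (0 : ℝ)..b, z ^ n * (z + 1) ^ s) b := by
  have hmeas : Measurable fun z : ℝ => z ^ n * (z + 1) ^ s := by fun_prop
  exact (intervalIntegral.integral_hasDerivAt_right
    (intervalIntegrable_greenIntegrand n s le_rfl hb)
    hmeas.stronglyMeasurable.stronglyMeasurableAtFilter
    (continuousAt_greenIntegrand n s hb)).continuousAt

/-- The Green kernels `G_R^+` of the balls `B_R^+` converge pointwise and monotonically
increasingly (in `R`) to the half-space kernel `G_∞^+`. -/
theorem stmt_2 {N m : ℕ} [NeZero N] (hm : 0 < m) (k : ℝ) (hk : 0 < k)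
    (x y : EuclideanSpace ℝ (Fin N)) (hx : 0 < x 0) (hy : 0 < y 0) (hxy : x ≠ y) :
    (∀ R R' : ℝ, R ≤ R' → ‖x - PP N R‖ < R → ‖y - PP N R‖ < R →
      psiR N R x y ≤ psiR N R' x y ∧ GreenBall N m k R x y ≤ GreenBall N m k R' x y) ∧
    Filter.Tendsto (fun R => psiR N R x y) Filter.atTop (nhds (psiInf x y)) ∧
    Filter.Tendsto (fun R => GreenBall N m k R x y) Filter.atTop
      (nhds (GreenHalf N m k x y)) := by
  refine ⟨fun R R' h hxR hyR => ⟨psiR_mono h hxR hyR, ?_⟩, tendsto_psiR x y, ?_⟩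
  · exact mul_le_mul_of_nonneg_left
      (integral_greenIntegrand_mono _ _ (psiR_nonneg hxR hyR) (psiR_mono h hxR hyR))
      (by positivity)
  · have hpsi : 0 ≤ psiInf x y := by rw [psiInf]; positivity
    exact ((continuousAt_integral_greenIntegrand _ _ hpsi).tendsto.comp
      (tendsto_psiR x y)).const_mul _
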